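/- arXiv:0910.2470 — 2 statements merged into one kernel-verified Lean document; each statement's English description precedes it below -/
import Mathlib

section
/- For every α > 0 and β > 0, setting α̃_N = Nα/(N+1), one has lim_{N→∞} ( E[ln Z_{N+1}(α,β)] − ln 2 − E[ln Z_N(α̃_N,β)] − Ψ_N(α̃_N,β,1) ) = 0. -/
open scoped BigOperators

noncomputable section

/-- The Poisson probability mass function with mean `lam`. -/
def pois (lam : ℝ) (k : ℕ) : ℝ := Real.exp (-lam) * lam ^ k / (Nat.factorial k)

/-- The spin value (±1) attached to a Boolean opinion. -/
def spin (b : Bool) : ℝ := if b then 1 else -1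

/-- Average of `f` over `p` families of `k` i.i.d. indices, each uniform on `Fin N`. -/
def avgIdx (N : ℕ) (p k : ℕ) (f : (Fin p → Fin k → Fin N) → ℝ) : ℝ :=
  ((N : ℝ) ^ (p * k))⁻¹ * ∑ im : Fin p → Fin k → Fin N, f im

/-- The interaction sum `∑_{ν=1}^k σ_{i_ν^1} ⋯ σ_{i_ν^p}`; the Hamiltonian is its negative. -/
def intSum {N p k : ℕ} (im : Fin p → Fin k → Fin N) (σ : Fin N → Bool) : ℝ :=
  ∑ ν : Fin k, ∏ l : Fin p, spin (σ (im l ν))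

/-- The diluted `p`-spin Hamiltonian `H = -∑_{ν=1}^k σ_{i_ν^1} ⋯ σ_{i_ν^p}`. -/
def Hspin {N p k : ℕ} (im : Fin p → Fin k → Fin N) (σ : Fin N → Bool) : ℝ :=
  - intSum im σ

/-- Partition function `Z = ∑_σ e^{-β H(σ)}`. -/
def Zpart (β : ℝ) {N p k : ℕ} (im : Fin p → Fin k → Fin N) : ℝ :=
  ∑ σ : Fin N → Bool, Real.exp (β * intSum im σ)

/-- Cavity term `∑_{ν=1}^{k'} σ_{i_ν^1} ⋯ σ_{i_ν^q}` (with `q = p - 1` families). -/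
def cavSum {N q k' : ℕ} (im' : Fin q → Fin k' → Fin N) (σ : Fin N → Bool) : ℝ :=
  ∑ ν : Fin k', ∏ l : Fin q, spin (σ (im' l ν))

/-- Perturbed Boltzmann weight `exp(β(∑_ν σ_{i_ν^1}⋯σ_{i_ν^p} + ∑_ν σ_{i'_ν^1}⋯σ_{i'_ν^{q}}))`. -/
def wpert (β : ℝ) {N p k q k' : ℕ} (im : Fin p → Fin k → Fin N)
    (im' : Fin q → Fin k' → Fin N) (σ : Fin N → Bool) : ℝ :=
  Real.exp (β * (intSum im σ + cavSum im' σ))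

/-- Perturbed partition function. -/
def Zpert (β : ℝ) {N p k q k' : ℕ} (im : Fin p → Fin k → Fin N)
    (im' : Fin q → Fin k' → Fin N) : ℝ :=
  ∑ σ : Fin N → Bool, wpert β im im' σ

/-- Replicated (unperturbed) Boltzmann state `Ω(g)` on `s` replicas sharing the same disorder. -/
def OmegaB (β : ℝ) {N p k : ℕ} (im : Fin p → Fin k → Fin N)
    (s : ℕ) (g : (Fin s → Fin N → Bool) → ℝ) : ℝ :=
  (∑ σs : Fin s → Fin N → Bool, g σs * ∏ a : Fin s, Real.exp (β * intSum im (σs a))) /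
    (Zpart β im) ^ s

/-- Replicated perturbed Boltzmann state `Ω̃_t(g)` on `s` replicas sharing the same disorder. -/
def OmegaPert (β : ℝ) {N p k q k' : ℕ} (im : Fin p → Fin k → Fin N)
    (im' : Fin q → Fin k' → Fin N) (s : ℕ) (g : (Fin s → Fin N → Bool) → ℝ) : ℝ :=
  (∑ σs : Fin s → Fin N → Bool, g σs * ∏ a : Fin s, wpert β im im' (σs a)) /
    (Zpert β im im') ^ s

/-- Quenched expectation: the number of interaction terms is Poisson of mean `γ N` and the
`p` index families are i.i.d. uniform on `Fin N`. -/
def Equench (N p : ℕ) (γ : ℝ) (f : (k : ℕ) → (Fin p → Fin k → Fin N) → ℝ) : ℝ :=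
  ∑' k : ℕ, pois (γ * N) k * avgIdx N p k (fun im => f k im)

/-- Quenched expectation including the cavity randomness: the cavity term has a Poisson
number of terms of mean `2 γ t`, with `p - 1` independent uniform index families. -/
def EquenchCav (N p : ℕ) (γ t : ℝ)
    (f : (k : ℕ) → (Fin p → Fin k → Fin N) →
         (k' : ℕ) → (Fin (p - 1) → Fin k' → Fin N) → ℝ) : ℝ :=
  ∑' k : ℕ, pois (γ * N) k * avgIdx N p k (fun im =>
    ∑' k' : ℕ, pois (2 * γ * t) k' * avgIdx N (p - 1) k' (fun im' => f k im k' im'))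

/-- Quenched average of `ln Z_N`. -/
def ElnZ (N p : ℕ) (γ β : ℝ) : ℝ :=
  Equench N p γ (fun _ im => Real.log (Zpart β im))

/-- Quenched pressure `A_N = (1/N) E[ln Z_N]`. -/
def pressure (N p : ℕ) (γ β : ℝ) : ℝ :=
  (N : ℝ)⁻¹ * ElnZ N p γ β

/-- Cavity function `Ψ_N(t) = E[ln (Z_{N,t} / Z_N)]`. -/
def cavityFn (N p : ℕ) (γ β t : ℝ) : ℝ :=
  EquenchCav N p γ t (fun _ im _ im' => Real.log (Zpert β im im' / Zpart β im))

/-- The multi-overlap `q_{1…n} = (1/N) ∑_i σ_i^{(1)} ⋯ σ_i^{(n)}` of `n` replicas. -/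
def qOv (N n : ℕ) (σs : Fin n → Fin N → Bool) : ℝ :=
  (N : ℝ)⁻¹ * ∑ x : Fin N, ∏ a : Fin n, spin (σs a x)

/-- Total (quenched) average `⟨q_{1…n}^r⟩_N` of the `r`-th power of the `n`-replica overlap. -/
def qPowAvg (N p : ℕ) (γ β : ℝ) (n r : ℕ) : ℝ :=
  Equench N p γ (fun _ im => OmegaB β im n (fun σs => (qOv N n σs) ^ r))

/-- Perturbed total average `⟨q_{1…n}^r⟩_{N,t}` of the `r`-th power of the `n`-replica overlap. -/
def qPowAvgPert (N p : ℕ) (γ β t : ℝ) (n r : ℕ) : ℝ :=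
  EquenchCav N p γ t (fun _ im _ im' => OmegaPert β im im' n (fun σs => (qOv N n σs) ^ r))

end

open Filter

section CompoundPoisson

variable {M X Y : Type*} [SeminormedAddCommGroup M] [Fintype X] [Fintype Y]

/-- The operator `F ↦ ∑ x, a x • F (· + g x)`, a weighted sum of translations. -/
noncomputable def shiftOp (a : X → ℝ) (g : X → M) : Module.End ℝ (M → ℝ) where
  toFun F m := ∑ x, a x * F (m + g x)
  map_add' F G := by
    ext m
    simp [mul_add, Finset.sum_add_distrib]
  map_smul' c F := by
    ext m
    simp [Finset.mul_sum, mul_left_comm]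

/-- Expectation of `F` at `m` plus the compound Poisson variable with jumps `g x` of
intensity `a x`. -/
noncomputable def compPois (a : X → ℝ) (g : X → M) (F : M → ℝ) (m : M) : ℝ :=
  Real.exp (-∑ x, a x) * ∑' k : ℕ, (shiftOp a g ^ k) F m / k.factorial

/-- Functions growing at most exponentially in the norm. -/
def ExpGrowth (F : M → ℝ) : Prop := ∃ K, ∀ m, |F m| ≤ K * Real.exp ‖m‖

lemma shiftOp_apply (a : X → ℝ) (g : X → M) (F : M → ℝ) (m : M) :
    shiftOp a g F m = ∑ x, a x * F (m + g x) := rfl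

lemma shiftOp_commute (a : X → ℝ) (g : X → M) (b : Y → ℝ) (h : Y → M) :
    Commute (shiftOp a g) (shiftOp b h) := by
  ext F m
  simp only [Module.End.mul_apply, shiftOp_apply, Finset.mul_sum]
  rw [Finset.sum_comm]
  refine Finset.sum_congr rfl fun y _ => Finset.sum_congr rfl fun x _ => ?_
  rw [add_right_comm]
  ring

lemma shiftOp_sumElim (a : X → ℝ) (g : X → M) (b : Y → ℝ) (h : Y → M) :
    shiftOp (Sum.elim a b) (Sum.elim g h) = shiftOp a g + shiftOp b h := by
  ext F m
  simp [shiftOp_apply]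

lemma shiftOp_pow_apply (a : X → ℝ) (g : X → M) (F : M → ℝ) (k : ℕ) (m : M) :
    (shiftOp a g ^ k) F m =
      ∑ x : Fin k → X, (∏ ν, a (x ν)) * F (m + ∑ ν, g (x ν)) := by
  induction k generalizing m with
  | zero => simp
  | succ k ih =>
    rw [pow_succ', Module.End.mul_apply, shiftOp_apply]
    simp only [ih]
    rw [← (Fin.consEquiv fun _ : Fin (k + 1) => X).sum_comp, Fintype.sum_prod_type]
    simp [Fin.consEquiv, Fin.sum_univ_succ, Fin.prod_univ_succ, Finset.mul_sum, add_assoc,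
      mul_assoc]

lemma abs_shiftOp_pow_le (a : X → ℝ) (g : X → M) {F : M → ℝ} {K : ℝ}
    (hF : ∀ m, |F m| ≤ K * Real.exp ‖m‖) (k : ℕ) (m : M) :
    |(shiftOp a g ^ k) F m| ≤
      K * (∑ x, |a x| * Real.exp ‖g x‖) ^ k * Real.exp ‖m‖ := by
  induction k generalizing m with
  | zero => simpa using hF m
  | succ k ih =>
    set L := ∑ x, |a x| * Real.exp ‖g x‖ with hL
    have hK : 0 ≤ K := nonneg_of_mul_nonneg_left ((abs_nonneg _).trans (hF 0)) (Real.exp_pos _)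
    have hL0 : 0 ≤ L := by positivity
    rw [pow_succ', Module.End.mul_apply, shiftOp_apply]
    calc |∑ x, a x * (shiftOp a g ^ k) F (m + g x)|
        ≤ ∑ x, |a x| * (K * L ^ k * (Real.exp ‖m‖ * Real.exp ‖g x‖)) := by
          refine (Finset.abs_sum_le_sum_abs _ _).trans (Finset.sum_le_sum fun x _ => ?_)
          rw [abs_mul, ← Real.exp_add]
          refine mul_le_mul_of_nonneg_left ((ih _).trans ?_) (abs_nonneg _)
          gcongr
          exact norm_add_le _ _
      _ = K * L ^ (k + 1) * Real.exp ‖m‖ := by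
          rw [pow_succ, hL, Finset.mul_sum, Finset.mul_sum, Finset.sum_mul]
          exact Finset.sum_congr rfl fun x _ => by ring

lemma summable_shiftOp_pow (a : X → ℝ) (g : X → M) {F : M → ℝ} (hF : ExpGrowth F) (m : M) :
    Summable fun k : ℕ => (shiftOp a g ^ k) F m / k.factorial := by
  obtain ⟨K, hK⟩ := hF
  refine Summable.of_norm_bounded
    (((Real.summable_pow_div_factorial (∑ x, |a x| * Real.exp ‖g x‖)).mul_left
      (K * Real.exp ‖m‖))) fun k => ?_
  rw [Real.norm_eq_abs, abs_div, Nat.abs_cast, ← mul_div_assoc]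
  gcongr
  linarith [abs_shiftOp_pow_le a g hK k m]

lemma hasSum_shiftOp_pow_apply (a : X → ℝ) (g : X → M) {ι : Type*} {f : ι → M → ℝ}
    {F : M → ℝ} (hf : ∀ m, HasSum (fun i => f i m) (F m)) (k : ℕ) (m : M) :
    HasSum (fun i => (shiftOp a g ^ k) (f i) m) ((shiftOp a g ^ k) F m) := by
  simp only [shiftOp_pow_apply]
  exact hasSum_sum fun x _ => (hf _).mul_left _

lemma ExpGrowth.const (c : ℝ) : ExpGrowth fun _ : M => c :=
  ⟨|c|, fun m => le_mul_of_one_le_right (abs_nonneg _) (Real.one_le_exp (norm_nonneg m))⟩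

lemma ExpGrowth.add {F G : M → ℝ} (hF : ExpGrowth F) (hG : ExpGrowth G) :
    ExpGrowth (F + G) := by
  obtain ⟨K, hK⟩ := hF
  obtain ⟨L, hL⟩ := hG
  refine ⟨K + L, fun m => (abs_add_le _ _).trans ?_⟩
  linarith [hK m, hL m]

lemma ExpGrowth.neg {F : M → ℝ} (hF : ExpGrowth F) : ExpGrowth (-F) := by
  obtain ⟨K, hK⟩ := hF
  exact ⟨K, fun m => by simpa using hK m⟩

lemma ExpGrowth.compPois (a : X → ℝ) (g : X → M) {F : M → ℝ} (hF : ExpGrowth F) :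
    ExpGrowth (compPois a g F) := by
  obtain ⟨K, hK⟩ := hF
  set L := ∑ x, |a x| * Real.exp ‖g x‖
  refine ⟨Real.exp (-∑ x, a x) * ∑' k : ℕ, K * (L ^ k / k.factorial), fun m => ?_⟩
  change |Real.exp (-∑ x, a x) * _| ≤ _
  rw [abs_mul, abs_of_pos (Real.exp_pos _), mul_assoc]
  refine mul_le_mul_of_nonneg_left ?_ (Real.exp_pos _).le
  rw [← tsum_mul_right, ← Real.norm_eq_abs]
  refine tsum_of_norm_bounded
    (((Real.summable_pow_div_factorial L).mul_left K).mul_right (Real.exp ‖m‖)).hasSum fun k => ?_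
  rw [Real.norm_eq_abs, abs_div, Nat.abs_cast, ← mul_div_assoc, div_mul_eq_mul_div]
  gcongr
  exact abs_shiftOp_pow_le a g hK k m

lemma compPois_add (a : X → ℝ) (g : X → M) {F G : M → ℝ} (hF : ExpGrowth F)
    (hG : ExpGrowth G) : compPois a g (F + G) = compPois a g F + compPois a g G := by
  ext m
  simp only [compPois, Pi.add_apply]
  rw [← mul_add, ← (summable_shiftOp_pow a g hF m).tsum_add (summable_shiftOp_pow a g hG m)]
  simp [add_div]

lemma compPois_const (a : X → ℝ) (g : X → M) (c : ℝ) :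
    compPois a g (fun _ => c) = fun _ => c := by
  ext m
  have h : ∀ k : ℕ, (shiftOp a g ^ k) (fun _ => c) = fun _ => (∑ x, a x) ^ k * c := by
    intro k
    induction k with
    | zero => ext; simp
    | succ k ih =>
      ext m
      rw [pow_succ', Module.End.mul_apply, ih, shiftOp_apply, ← Finset.sum_mul]
      ring
  simp only [compPois, h, mul_div_right_comm]
  rw [tsum_mul_right, ← congrFun (NormedSpace.exp_eq_tsum_div (𝔸 := ℝ)),
    ← Real.exp_eq_exp_ℝ, ← mul_assoc, ← Real.exp_add, neg_add_cancel, Real.exp_zero, one_mul]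

lemma compPois_congr {a : X → ℝ} {g : X → M} {b : Y → ℝ} {h : Y → M}
    (H : shiftOp a g = shiftOp b h) : compPois a g = compPois b h := by
  have hsum : ∑ x, a x = ∑ y, b y := by
    simpa [shiftOp_apply] using congrFun (LinearMap.congr_fun H fun _ => 1) 0
  ext F m
  rw [compPois, compPois, H, hsum]

/-- Independent superposition of compound Poisson variables. -/
lemma compPois_sumElim (a : X → ℝ) (g : X → M) (b : Y → ℝ) (h : Y → M) {F : M → ℝ}
    (hF : ExpGrowth F) :
    compPois (Sum.elim a b) (Sum.elim g h) F = compPois a g (compPois b h F) := by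
  ext m
  obtain ⟨K, hK⟩ := id hF
  set A := shiftOp a g
  set B := shiftOp b h
  set L := ∑ y, |b y| * Real.exp ‖h y‖
  set L' := ∑ x, |a x| * Real.exp ‖g x‖
  let u : ℕ × ℕ → ℝ := fun p =>
    (A ^ p.1) ((B ^ p.2) F) m / (p.1.factorial * p.2.factorial)
  have hu : Summable u := by
    refine Summable.of_norm_bounded
      ((((Real.summable_pow_div_factorial L').mul_of_nonneg (Real.summable_pow_div_factorial L)
        (fun k => by positivity) (fun k => by positivity)).mul_left
        (K * Real.exp ‖m‖))) fun p => ?_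
    rw [Real.norm_eq_abs, abs_div, abs_mul, Nat.abs_cast, Nat.abs_cast, div_mul_div_comm,
      ← mul_div_assoc]
    gcongr
    linarith [abs_shiftOp_pow_le a g (abs_shiftOp_pow_le b h hK p.2) p.1 m]
  have hleft : ∑' k : ℕ, ((A + B) ^ k) F m / k.factorial = ∑' p, u p := by
    have hsig : Summable fun p : Σ n : ℕ, Finset.HasAntidiagonal.antidiagonal n =>
        u (Finset.HasAntidiagonal.sigmaAntidiagonalEquivProd p) :=
      Finset.HasAntidiagonal.sigmaAntidiagonalEquivProd.summable_iff.mpr hu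
    rw [← Finset.HasAntidiagonal.sigmaAntidiagonalEquivProd.tsum_eq u,
      hsig.tsum_sigma' fun n => (hasSum_fintype _).summable]
    refine tsum_congr fun n => ?_
    rw [tsum_fintype, (shiftOp_commute a g b h).add_pow']
    simp only [LinearMap.sum_apply, Finset.sum_apply, Finset.sum_div]
    rw [← Finset.sum_coe_sort]
    refine Finset.sum_congr rfl fun p _ => ?_
    obtain ⟨⟨i, j⟩, hp⟩ := p
    have hn : n = i + j := (Finset.HasAntidiagonal.mem_antidiagonal.mp hp).symm
    have hfac : ((n.choose i : ℝ)) * i.factorial * j.factorial = n.factorial := by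
      subst hn
      rw [Nat.choose_symm_add]
      exact_mod_cast Nat.add_choose_mul_factorial_mul_factorial i j
    have hchoose : (n.choose i : ℝ) ≠ 0 := by
      subst hn
      exact_mod_cast (Nat.choose_pos (Nat.le_add_right i j)).ne'
    simp only [u, Finset.HasAntidiagonal.sigmaAntidiagonalEquivProd_apply, LinearMap.smul_apply,
      Pi.smul_apply, Module.End.mul_apply]
    rw [nsmul_eq_mul, ← hfac, mul_assoc, mul_div_mul_left _ _ hchoose]
  have hright : ∑' p, u p =
      ∑' i : ℕ, (A ^ i) (fun m' => ∑' j : ℕ, (B ^ j) F m' / j.factorial) m / i.factorial := by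
    rw [hu.tsum_prod]
    refine tsum_congr fun i => ?_
    have := hasSum_shiftOp_pow_apply a g (fun m' => (summable_shiftOp_pow b h hF m').hasSum) i m
    rw [← this.tsum_eq, ← tsum_div_const]
    refine tsum_congr fun j => ?_
    have hj : (fun m' => (B ^ j) F m' / j.factorial) = (j.factorial : ℝ)⁻¹ • (B ^ j) F := by
      ext m'
      simp [div_eq_inv_mul]
    change u (i, j) = (A ^ i) (fun m' => (B ^ j) F m' / j.factorial) m / _
    rw [hj, map_smul, Pi.smul_apply, smul_eq_mul]
    simp only [u]
    field_simp
  have hscale : compPois b h F = Real.exp (-∑ y, b y) •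
      fun m' => ∑' j : ℕ, (B ^ j) F m' / j.factorial := rfl
  rw [hscale]
  simp only [compPois, shiftOp_sumElim]
  rw [hleft, hright]
  simp only [map_smul, Pi.smul_apply, smul_eq_mul, mul_div_assoc]
  rw [tsum_mul_left, Fintype.sum_sum_type, neg_add, Real.exp_add]
  simp only [Sum.elim_inl, Sum.elim_inr]
  ring

lemma hasSum_pois_mul (c : ℝ) :
    HasSum (fun k : ℕ => c ^ k / k.factorial * k) (c * Real.exp c) := by
  rw [← hasSum_nat_add_iff' 1]
  have h : HasSum (fun k : ℕ => c ^ k / k.factorial) (Real.exp c) := by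
    rw [Real.exp_eq_exp_ℝ]
    exact NormedSpace.expSeries_div_hasSum_exp c
  simp only [Finset.range_one, Finset.sum_singleton, Nat.cast_zero, mul_zero, sub_zero]
  refine (h.mul_left c).congr_fun fun k => ?_
  rw [Nat.factorial_succ]
  push_cast
  field_simp
  ring

/-- A compound Poisson variable whose only jump adds a constant to `F`. -/
lemma compPois_unit {c d : ℝ} {m₀ : M} {F : M → ℝ} (h : ∀ m, F (m + m₀) = F m + d) :
    compPois (fun _ : Unit => c) (fun _ => m₀) F = F + fun _ => c * d := by
  ext m
  have hpow : ∀ (k : ℕ) m, (shiftOp (fun _ : Unit => c) (fun _ => m₀) ^ k) F m =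
      c ^ k * (F m + k * d) := by
    intro k
    induction k with
    | zero => simp
    | succ k ih =>
      intro m
      rw [pow_succ', Module.End.mul_apply, shiftOp_apply]
      simp only [ih, h, Finset.univ_unique, Finset.sum_singleton]
      push_cast
      ring
  have hexp : HasSum (fun k : ℕ => c ^ k / k.factorial) (Real.exp c) := by
    rw [Real.exp_eq_exp_ℝ]
    exact NormedSpace.expSeries_div_hasSum_exp c
  have key := (hexp.mul_right (F m)).add ((hasSum_pois_mul c).mul_right d)
  have : ∑' k : ℕ, (shiftOp (fun _ : Unit => c) (fun _ => m₀) ^ k) F m / k.factorial =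
      Real.exp c * F m + c * Real.exp c * d := by
    rw [← key.tsum_eq]
    refine tsum_congr fun k => ?_
    rw [hpow]
    ring
  rw [compPois, this]
  simp only [Finset.univ_unique, Finset.sum_singleton, Pi.add_apply]
  have he : Real.exp (-c) * Real.exp c = 1 := by rw [← Real.exp_add]; simp
  linear_combination (F m + c * d) * he

/-- Poisson number of i.i.d. uniform index families as a compound Poisson variable. -/
lemma tsum_pois_avgIdx {N : ℕ} (hN : N ≠ 0) (p : ℕ) (lam : ℝ) (g : (Fin p → Fin N) → M)
    (F : M → ℝ) (m : M) :
    ∑' k : ℕ, pois lam k * avgIdx N p k (fun im => F (m + ∑ ν, g fun l => im l ν)) =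
      compPois (fun _ => lam / (N : ℝ) ^ p) g F m := by
  have hN' : (N : ℝ) ≠ 0 := Nat.cast_ne_zero.mpr hN
  rw [compPois, ← tsum_mul_left]
  refine tsum_congr fun k => ?_
  have hsum : ∑ _x : Fin p → Fin N, lam / (N : ℝ) ^ p = lam := by
    simp
    field_simp
  rw [hsum, shiftOp_pow_apply, pois, avgIdx,
    ← (Equiv.piComm fun (_ : Fin k) (_ : Fin p) => Fin N).sum_comp]
  simp only [Finset.prod_const, Finset.card_univ, Fintype.card_fin, ← Finset.mul_sum, div_pow,
    ← pow_mul, Equiv.piComm_apply, Function.swap]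
  field_simp

end CompoundPoisson

section CurieWeiss

variable {N : ℕ}

/-- The free energy of an energy profile `m`. -/
noncomputable def logZ (β : ℝ) (m : (Fin N → Bool) → ℝ) : ℝ :=
  Real.log (∑ σ, Real.exp (β * m σ))

/-- The `p`-spin monomial with indices `x`. -/
noncomputable def monomialSpin (p : ℕ) (x : Fin p → Fin N) : (Fin N → Bool) → ℝ :=
  fun σ => ∏ l, spin (σ (x l))

/-- The `p`-spin monomial on `N + 1` spins, the last of which is fixed to `1`. -/
noncomputable def pinnedMonomialSpin (p : ℕ) (x : Fin p → Fin (N + 1)) : (Fin N → Bool) → ℝ :=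
  fun σ => ∏ l, spin ((Fin.snoc σ true : Fin (N + 1) → Bool) (x l))

lemma sum_exp_pos (β : ℝ) (m : (Fin N → Bool) → ℝ) : 0 < ∑ σ, Real.exp (β * m σ) :=
  Finset.sum_pos (fun _ _ => Real.exp_pos _) Finset.univ_nonempty

lemma expGrowth_logZ (β : ℝ) : ExpGrowth (logZ (N := N) β) := by
  refine ⟨Real.log (2 ^ N) + |β|, fun m => ?_⟩
  have hm : ∀ σ, |β * m σ| ≤ |β| * ‖m‖ := fun σ => by
    rw [abs_mul]
    exact mul_le_mul_of_nonneg_left (norm_le_pi_norm m σ) (abs_nonneg _)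
  have h2 : (0 : ℝ) ≤ Real.log (2 ^ N) := Real.log_nonneg (one_le_pow₀ one_le_two)
  have hub : logZ β m ≤ Real.log (2 ^ N) + |β| * ‖m‖ := by
    rw [logZ, ← Real.log_exp (|β| * ‖m‖), ← Real.log_mul (by positivity) (Real.exp_pos _).ne']
    refine Real.log_le_log (sum_exp_pos β m) ?_
    calc ∑ σ, Real.exp (β * m σ) ≤ ∑ _σ : Fin N → Bool, Real.exp (|β| * ‖m‖) :=
          Finset.sum_le_sum fun σ _ => Real.exp_le_exp.mpr ((le_abs_self _).trans (hm σ))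
      _ = _ := by simp
  have hlb : -(|β| * ‖m‖) ≤ logZ β m := by
    rw [logZ, Real.le_log_iff_exp_le (sum_exp_pos β m)]
    refine (Real.exp_le_exp.mpr (abs_le.mp (hm fun _ => true)).1).trans ?_
    exact Finset.single_le_sum (f := fun σ => Real.exp (β * m σ))
      (fun σ _ => (Real.exp_pos _).le) (Finset.mem_univ _)
  have h1 : 1 ≤ Real.exp ‖m‖ := Real.one_le_exp (norm_nonneg _)
  have h3 : ‖m‖ ≤ Real.exp ‖m‖ := by linarith [Real.add_one_le_exp ‖m‖]
  have h4 : |β| * ‖m‖ ≤ |β| * Real.exp ‖m‖ := mul_le_mul_of_nonneg_left h3 (abs_nonneg _)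
  have h5 : Real.log (2 ^ N) ≤ Real.log (2 ^ N) * Real.exp ‖m‖ := le_mul_of_one_le_right h2 h1
  rw [abs_le]
  constructor <;> linarith

lemma logZ_add_const (β : ℝ) (m : (Fin N → Bool) → ℝ) :
    logZ β (m + fun _ => 1) = logZ β m + β := by
  simp only [logZ, Pi.add_apply, mul_add, mul_one, Real.exp_add, ← Finset.sum_mul]
  rw [Real.log_mul (sum_exp_pos β m).ne' (Real.exp_pos _).ne', Real.log_exp]

lemma intSum_eq {p k : ℕ} (im : Fin p → Fin k → Fin N) :
    intSum im = ∑ ν, monomialSpin p fun l => im l ν := by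
  ext σ
  simp [intSum, monomialSpin]

lemma cavSum_eq {p k : ℕ} (im : Fin p → Fin k → Fin N) :
    cavSum im = ∑ ν, monomialSpin p fun l => im l ν := by
  ext σ
  simp [cavSum, monomialSpin]

lemma spin_not (b : Bool) : spin (!b) = -spin b := by cases b <;> simp [spin]

/-- Gauge symmetry of the two-spin interaction. -/
lemma intSum_not {k : ℕ} (im : Fin 2 → Fin k → Fin N) (σ : Fin N → Bool) :
    intSum im (fun i => !σ i) = intSum im σ := by
  simp [intSum, spin_not]

lemma log_Zpart_succ (β : ℝ) {k : ℕ} (im : Fin 2 → Fin k → Fin (N + 1)) :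
    Real.log (Zpart β im) =
      logZ β (∑ ν, pinnedMonomialSpin 2 fun l => im l ν) + Real.log 2 := by
  have htrue : ∀ σ : Fin N → Bool, intSum im (Fin.snoc σ true : Fin (N + 1) → Bool) =
      (∑ ν, pinnedMonomialSpin 2 fun l => im l ν) σ := fun σ => by
    simp only [intSum, pinnedMonomialSpin, Finset.sum_apply]
  have hfalse : ∀ σ : Fin N → Bool,
      intSum im (Fin.snoc (fun i => !σ i) false : Fin (N + 1) → Bool) =
        intSum im (Fin.snoc σ true : Fin (N + 1) → Bool) := fun σ => by
    rw [← intSum_not]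
    congr 1
    ext i
    refine Fin.lastCases ?_ (fun j => ?_) i <;> simp
  have hnot : Function.Involutive fun σ : Fin N → Bool => fun i => !σ i := fun σ => by simp
  have hZ : Zpart β im =
      (∑ σ, Real.exp (β * (∑ ν, pinnedMonomialSpin 2 fun l => im l ν) σ)) * 2 := by
    rw [Zpart, ← (Fin.snocEquiv fun _ : Fin (N + 1) => Bool).sum_comp, Fintype.sum_prod_type,
      Fintype.sum_bool, mul_two]
    congr 1
    · exact Finset.sum_congr rfl fun σ _ => by rw [← htrue]; rfl
    · rw [← Equiv.sum_comp hnot.toPerm]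
      exact Finset.sum_congr rfl fun σ _ => by rw [← htrue, ← hfalse]; rfl
  rw [hZ, Real.log_mul (sum_exp_pos _ _).ne' two_ne_zero, logZ]

lemma shiftOp_pinnedMonomialSpin (c : ℝ) :
    shiftOp (fun _ => c) (pinnedMonomialSpin (N := N) 2) =
      shiftOp (Sum.elim (fun _ => c) (Sum.elim (fun _ => 2 * c) fun _ : Unit => c))
        (Sum.elim (monomialSpin (N := N) 2)
          (Sum.elim (monomialSpin (2 - 1)) fun _ _ => 1)) := by
  ext F m
  have hcc : ∀ i j : Fin N, pinnedMonomialSpin 2 ![i.castSucc, j.castSucc] =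
      monomialSpin 2 ![i, j] := fun i j => by
    ext σ
    simp [pinnedMonomialSpin, monomialSpin]
  have hcl : ∀ i : Fin N, pinnedMonomialSpin 2 ![i.castSucc, Fin.last N] =
      monomialSpin 1 fun _ => i := fun i => by
    ext σ
    simp [pinnedMonomialSpin, monomialSpin, spin]
  have hlc : ∀ i : Fin N, pinnedMonomialSpin 2 ![Fin.last N, i.castSucc] =
      monomialSpin 1 fun _ => i := fun i => by
    ext σ
    simp [pinnedMonomialSpin, monomialSpin, spin]
  have hll : pinnedMonomialSpin 2 ![Fin.last N, Fin.last N] = fun _ => 1 := by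
    ext σ
    simp [pinnedMonomialSpin, spin]
  have h1 : ∑ x : Fin (2 - 1) → Fin N, 2 * c * F (m + monomialSpin (2 - 1) x) =
      ∑ i, 2 * c * F (m + monomialSpin 1 fun _ => i) :=
    ((Equiv.funUnique (Fin 1) (Fin N)).symm.sum_comp _).symm
  simp only [shiftOp_apply, Fintype.sum_sum_type, Sum.elim_inl, Sum.elim_inr, h1]
  rw [← (finTwoArrowEquiv (Fin (N + 1))).symm.sum_comp,
    ← (finTwoArrowEquiv (Fin N)).symm.sum_comp]
  simp only [Fintype.sum_prod_type, finTwoArrowEquiv_symm_apply, Fin.sum_univ_castSucc, hcc, hcl,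
    hlc, hll, Finset.sum_add_distrib, Finset.univ_unique, Finset.sum_singleton, mul_assoc,
    ← Finset.mul_sum]
  ring

lemma ElnZ_eq (hN : N ≠ 0) (p : ℕ) (γ β : ℝ) :
    ElnZ N p γ β =
      compPois (fun _ => γ * N / (N : ℝ) ^ p) (monomialSpin (N := N) p) (logZ β) 0 := by
  rw [← tsum_pois_avgIdx hN]
  simp only [zero_add, ← intSum_eq]
  rfl

lemma ElnZ_succ_eq (γ β : ℝ) :
    ElnZ (N + 1) 2 γ β =
      compPois (fun _ => γ * (N + 1 : ℕ) / ((N + 1 : ℕ) : ℝ) ^ 2) (pinnedMonomialSpin (N := N) 2)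
        (logZ β + fun _ => Real.log 2) 0 := by
  rw [← tsum_pois_avgIdx N.succ_ne_zero]
  simp only [zero_add, Pi.add_apply, ← log_Zpart_succ]
  rfl

lemma cavityFn_eq (hN : N ≠ 0) (p : ℕ) (γ β t : ℝ) :
    cavityFn N p γ β t =
      compPois (fun _ => γ * N / (N : ℝ) ^ p) (monomialSpin (N := N) p)
        (compPois (fun _ => 2 * γ * t / (N : ℝ) ^ (p - 1)) (monomialSpin (p - 1)) (logZ β)
          + -logZ β) 0 := by
  rw [← tsum_pois_avgIdx hN]
  rw [cavityFn, EquenchCav]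
  refine tsum_congr fun k => ?_
  congr 2
  ext im
  have hadd : ∀ m : (Fin N → Bool) → ℝ,
      compPois (fun _ => 2 * γ * t / (N : ℝ) ^ (p - 1)) (monomialSpin (p - 1)) (logZ β) m +
        -logZ β m =
      compPois (fun _ => 2 * γ * t / (N : ℝ) ^ (p - 1)) (monomialSpin (p - 1))
        (logZ β + fun _ => -logZ β m) m := fun m => by
    rw [compPois_add _ _ (expGrowth_logZ β) (.const _), compPois_const]
    rfl
  rw [Pi.add_apply, Pi.neg_apply, hadd, ← tsum_pois_avgIdx hN]
  refine tsum_congr fun k' => ?_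
  congr 2
  ext im'
  rw [zero_add, ← intSum_eq, ← cavSum_eq, Pi.add_apply, ← sub_eq_add_neg,
    Real.log_div (x := Zpert β im im') (y := Zpart β im)
      (sum_exp_pos β (intSum im + cavSum im')).ne' (sum_exp_pos β (intSum im)).ne']
  rfl

/-- The cavity decomposition holds up to the mean contribution of the self-loops at the
added spin. -/
lemma cavity_decomposition (hN : N ≠ 0) (α β : ℝ) :
    ElnZ (N + 1) 2 α β - Real.log 2
        - ElnZ N 2 ((N : ℝ) * α / ((N : ℝ) + 1)) β
        - cavityFn N 2 ((N : ℝ) * α / ((N : ℝ) + 1)) β 1 = α / (N + 1) * β := by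
  have hN' : (N : ℝ) ≠ 0 := Nat.cast_ne_zero.mpr hN
  have hN1 : (N : ℝ) + 1 ≠ 0 := N.cast_add_one_ne_zero
  set c := α / ((N : ℝ) + 1) with hc
  have w1 : α * (N + 1 : ℕ) / ((N + 1 : ℕ) : ℝ) ^ 2 = c := by
    push_cast
    rw [hc]
    field_simp
  have w2 : (N : ℝ) * α / ((N : ℝ) + 1) * N / (N : ℝ) ^ 2 = c := by
    rw [hc]
    field_simp
  have w3 : 2 * ((N : ℝ) * α / ((N : ℝ) + 1)) * 1 / (N : ℝ) ^ (2 - 1) = 2 * c := by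
    rw [hc]
    norm_num
    field_simp
  have hF := expGrowth_logZ (N := N) β
  rw [ElnZ_succ_eq, ElnZ_eq hN, cavityFn_eq hN, w1, w2, w3,
    compPois_congr (shiftOp_pinnedMonomialSpin c), compPois_add _ _ hF (.const _),
    compPois_const, compPois_sumElim _ _ _ _ hF, compPois_sumElim _ _ _ _ hF,
    compPois_unit (logZ_add_const β), compPois_add _ _ hF (.const _), compPois_const,
    compPois_add _ _ (hF.compPois _ _) (.const _), compPois_const,
    compPois_add _ _ (hF.compPois _ _) hF.neg]
  have hneg : compPois (fun _ => c) (monomialSpin (N := N) 2) (-logZ β) 0 =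
      -compPois (fun _ => c) (monomialSpin (N := N) 2) (logZ β) 0 := by
    have h := congrFun (compPois_add (fun _ => c) (monomialSpin (N := N) 2) hF hF.neg) 0
    rw [add_neg_cancel] at h
    have h0 : compPois (fun _ => c) (monomialSpin (N := N) 2) 0 0 = 0 :=
      congrFun (compPois_const _ _ 0) 0
    rw [h0, Pi.add_apply] at h
    linarith
  simp only [Pi.add_apply, hneg]
  ring

end CurieWeiss

/-- Interpolation step of the cavity method for the diluted Curie–Weiss model (`p = 2`,
`γ = α`): with `α̃_N = Nα/(N+1)`,
`E[ln Z_{N+1}(α,β)] - ln 2 - E[ln Z_N(α̃_N,β)] - Ψ_N(α̃_N,β,1) → 0` as `N → ∞`. -/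
theorem cavity_decomposition_limit (α β : ℝ) (hα : 0 < α) (hβ : 0 < β) :
    Tendsto (fun N : ℕ =>
        ElnZ (N + 1) 2 α β - Real.log 2
          - ElnZ N 2 ((N : ℝ) * α / ((N : ℝ) + 1)) β
          - cavityFn N 2 ((N : ℝ) * α / ((N : ℝ) + 1)) β 1)
      atTop (nhds 0) := by
  have hlim : Tendsto (fun N : ℕ => α / ((N : ℝ) + 1) * β) atTop (nhds 0) := by
    have := (tendsto_one_div_add_atTop_nhds_zero_nat (𝕜 := ℝ)).const_mul (α * β)
    rw [mul_zero] at this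
    exact this.congr fun N => by ring
  refine hlim.congr' ?_
  filter_upwards [eventually_ne_atTop 0] with N hN
  exact (cavity_decomposition hN α β).symm
end

section
/- For every N ∈ ℕ, α > 0, β > 0 and t ∈ [0,1], the cavity function is differentiable in t and ∂Ψ_N(α,β,t)/∂t = 2α ln cosh β − 2α ∑_{n=1}^∞ ((−1)^n/n) θ^n ⟨q_{1…n}⟩_{N,t}, where θ = tanh β and the series converges absolutely. -/
open scoped BigOperators

section PoissonSeries

lemma hasSum_pois (l : ℝ) : HasSum (pois l) 1 := by
  have h := (NormedSpace.expSeries_div_hasSum_exp l).mul_left (Real.exp (-l))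
  rw [← Real.exp_eq_exp_ℝ, ← Real.exp_add, neg_add_cancel, Real.exp_zero] at h
  exact h.congr_fun fun k => by simp [pois, mul_div_assoc]

lemma summable_abs_pois (l : ℝ) : Summable fun k => |pois l k| :=
  (hasSum_pois l).summable.abs

lemma tsum_abs_pois (l : ℝ) : ∑' k, |pois l k| = Real.exp (|l| - l) := by
  have h := (hasSum_pois |l|).mul_left (Real.exp (|l| - l))
  rw [mul_one] at h
  refine (h.congr_fun fun k => ?_).tsum_eq
  simp only [pois, abs_div, abs_mul, abs_pow, Real.abs_exp, Nat.abs_cast]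
  rw [← mul_div_assoc, ← mul_assoc, ← Real.exp_add]
  ring_nf

lemma summable_weight_mul {w g : ℕ → ℝ} {c : ℝ} (hw : Summable fun k => |w k|)
    (hg : ∀ k, |g k| ≤ c) : Summable fun k => w k * g k :=
  (hw.mul_right c).of_norm_bounded fun k => by
    rw [Real.norm_eq_abs, abs_mul]
    exact mul_le_mul_of_nonneg_left (hg k) (abs_nonneg _)

lemma abs_tsum_weight_mul_le {w g : ℕ → ℝ} {c : ℝ} (hw : Summable fun k => |w k|)
    (hg : ∀ k, |g k| ≤ c) : |∑' k, w k * g k| ≤ (∑' k, |w k|) * c :=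
  tsum_of_norm_bounded (hw.hasSum.mul_right c) fun k => by
    rw [Real.norm_eq_abs, abs_mul]
    exact mul_le_mul_of_nonneg_left (hg k) (abs_nonneg _)

lemma hasSum_tsum_weight_mul {w : ℕ → ℝ} {g : ℕ → ℕ → ℝ} {G c : ℕ → ℝ}
    (hw : Summable fun k => |w k|) (hc : Summable c) (hg : ∀ n k, |g n k| ≤ c n)
    (hG : ∀ k, HasSum (fun n => g n k) (G k)) :
    HasSum (fun n => ∑' k, w k * g n k) (∑' k, w k * G k) := by
  have hc0 : 0 ≤ c := fun n => (abs_nonneg _).trans (hg n 0)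
  have hs : Summable fun x : ℕ × ℕ => w x.2 * g x.1 x.2 :=
    (hc.mul_of_nonneg hw hc0 fun k => abs_nonneg _).of_norm_bounded fun x => by
      rw [Real.norm_eq_abs, abs_mul, mul_comm]
      exact mul_le_mul_of_nonneg_right (hg _ _) (abs_nonneg _)
  have hsum : Summable fun n => ∑' k, w k * g n k := hs.prod
  have htot : ∑' k, w k * G k = ∑' n, ∑' k, w k * g n k := by
    rw [← hs.tsum_comm]
    exact tsum_congr fun k => ((hG k).mul_left (w k)).tsum_eq.symm
  rw [htot]
  exact hsum.hasSum

lemma tsum_weight_mul_const_sub {w g : ℕ → ℝ} {B : ℝ} (c : ℝ) (hw : HasSum w 1)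
    (hg : ∀ k, |g k| ≤ B) : ∑' k, w k * (c - g k) = c - ∑' k, w k * g k := by
  have h := (hw.mul_right c).sub (summable_weight_mul hw.summable.abs hg).hasSum
  rw [one_mul] at h
  exact (h.congr_fun fun k => by ring).tsum_eq

lemma summable_pow_div_factorial_mul {a : ℕ → ℝ} {C : ℝ} (ha : ∀ k, |a k| ≤ C * 2 ^ k)
    (x : ℝ) : Summable fun k => x ^ k / (k.factorial : ℝ) * a k :=
  ((Real.summable_pow_div_factorial (|x| * 2)).mul_left C).of_norm_bounded fun k => by
    rw [Real.norm_eq_abs, abs_mul, abs_div, abs_pow, Nat.abs_cast]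
    calc |x| ^ k / (k.factorial : ℝ) * |a k|
        ≤ |x| ^ k / (k.factorial : ℝ) * (C * 2 ^ k) :=
          mul_le_mul_of_nonneg_left (ha k) (by positivity)
      _ = C * ((|x| * 2) ^ k / (k.factorial : ℝ)) := by rw [mul_pow]; ring

/-- Differentiating an exponential generating function shifts its coefficients. -/
lemma hasDerivAt_tsum_pow_div_factorial {a : ℕ → ℝ} {C : ℝ} (ha : ∀ k, |a k| ≤ C * 2 ^ k)
    (l : ℝ) :
    HasDerivAt (fun x => ∑' k, x ^ k / (k.factorial : ℝ) * a k)
      (∑' k, l ^ k / (k.factorial : ℝ) * a (k + 1)) l := by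
  have ha' : ∀ k, |a (k + 1)| ≤ (2 * C) * 2 ^ k := fun k =>
    (ha (k + 1)).trans_eq (by ring)
  have hshift : ∀ (x b : ℝ) (k : ℕ),
      ((k + 1 : ℕ) : ℝ) * x ^ k / ((k + 1).factorial : ℝ) * b =
        x ^ k / (k.factorial : ℝ) * b := fun x b k => by
    rw [Nat.factorial_succ, Nat.cast_mul, mul_div_mul_left _ _ (by positivity)]
  set R := |l| + 1
  have hl : l ∈ Set.Ioo (-R) R := abs_lt.1 (lt_add_one _)
  have hu : Summable fun k : ℕ => k * R ^ (k - 1) / (k.factorial : ℝ) * |a k| := by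
    rw [← summable_nat_add_iff 1]
    simp only [Nat.add_sub_cancel, hshift]
    exact summable_pow_div_factorial_mul (fun k => by rw [abs_abs]; exact ha' k) R
  have hderiv := hasDerivAt_tsum_of_isPreconnected hu isOpen_Ioo isPreconnected_Ioo
    (g := fun k x => x ^ k / (k.factorial : ℝ) * a k)
    (g' := fun k x => k * x ^ (k - 1) / (k.factorial : ℝ) * a k)
    (fun k y _ => ((hasDerivAt_pow k y).div_const _).mul_const _)
    (fun k y hy => by
      have hy : |y| ≤ R := (abs_lt.2 hy).le
      rw [Real.norm_eq_abs, abs_mul, abs_div, abs_mul, abs_pow, Nat.abs_cast, Nat.abs_cast]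
      gcongr)
    hl (summable_pow_div_factorial_mul ha l) hl
  refine hderiv.congr_deriv ?_
  have hs : Summable fun k : ℕ => k * l ^ (k - 1) / (k.factorial : ℝ) * a k := by
    rw [← summable_nat_add_iff 1]
    simp only [Nat.add_sub_cancel, hshift]
    exact summable_pow_div_factorial_mul ha' l
  rw [hs.tsum_eq_zero_add]
  simp only [Nat.add_sub_cancel, hshift, Nat.cast_zero, zero_mul, zero_div, zero_add]

lemma hasDerivAt_tsum_pois {a : ℕ → ℝ} {C : ℝ} (ha : ∀ k, |a k| ≤ C * k) (l : ℝ) :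
    HasDerivAt (fun x => ∑' k, pois x k * a k)
      (∑' k, pois l k * (a (k + 1) - a k)) l := by
  have hC : 0 ≤ C := by simpa using (abs_nonneg _).trans (ha 1)
  have ha₂ : ∀ k, |a k| ≤ C * 2 ^ k := fun k => (ha k).trans
    (mul_le_mul_of_nonneg_left (by exact_mod_cast Nat.lt_two_pow_self.le) hC)
  have ha' : ∀ k, |a (k + 1)| ≤ (2 * C) * 2 ^ k := fun k =>
    (ha₂ (k + 1)).trans_eq (by ring)
  have hpois : ∀ x b k, pois x k * b = Real.exp (-x) * (x ^ k / (k.factorial : ℝ) * b) :=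
    fun x b k => by rw [pois]; ring
  simp only [hpois, tsum_mul_left, mul_sub]
  rw [(summable_pow_div_factorial_mul ha' l).mul_left _ |>.tsum_sub
    ((summable_pow_div_factorial_mul ha₂ l).mul_left _), tsum_mul_left, tsum_mul_left]
  refine ((hasDerivAt_neg l).exp.mul (hasDerivAt_tsum_pow_div_factorial ha₂ l)).congr_deriv ?_
  ring

end PoissonSeries

section QuenchedAverage

variable {N : ℕ}

lemma avgIdx_const (hN : 0 < N) (p k : ℕ) (c : ℝ) : avgIdx N p k (fun _ => c) = c := by
  have hN' : (N : ℝ) ≠ 0 := by positivity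
  simp [avgIdx, mul_comm p k, pow_mul]
  field_simp

lemma abs_avgIdx_le (hN : 0 < N) {p k : ℕ} {f : (Fin p → Fin k → Fin N) → ℝ} {B : ℝ}
    (hf : ∀ im, |f im| ≤ B) : |avgIdx N p k f| ≤ B := by
  rw [← avgIdx_const hN p k B]
  simp only [avgIdx]
  rw [abs_mul, abs_of_nonneg (by positivity : (0 : ℝ) ≤ ((N : ℝ) ^ (p * k))⁻¹)]
  gcongr
  exact (Finset.abs_sum_le_sum_abs _ _).trans (Finset.sum_le_sum fun im _ => hf im)

lemma avgIdx_const_sub (hN : 0 < N) {p k : ℕ} (c : ℝ) (f : (Fin p → Fin k → Fin N) → ℝ) :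
    avgIdx N p k (fun im => c - f im) = c - avgIdx N p k f := by
  conv_rhs => rw [← avgIdx_const hN p k c]
  simp only [avgIdx, Finset.sum_sub_distrib, mul_sub]

lemma avgIdx_sub {p k : ℕ} (f g : (Fin p → Fin k → Fin N) → ℝ) :
    avgIdx N p k (fun im => f im - g im) = avgIdx N p k f - avgIdx N p k g := by
  simp only [avgIdx, Finset.sum_sub_distrib, mul_sub]

lemma hasSum_avgIdx {p k : ℕ} {f : ℕ → (Fin p → Fin k → Fin N) → ℝ}
    {F : (Fin p → Fin k → Fin N) → ℝ} (h : ∀ im, HasSum (fun n => f n im) (F im)) :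
    HasSum (fun n => avgIdx N p k (f n)) (avgIdx N p k F) :=
  (hasSum_sum fun im _ => h im).mul_left _

lemma hasDerivAt_avgIdx {p k : ℕ} {f : (Fin p → Fin k → Fin N) → ℝ → ℝ}
    {f' : (Fin p → Fin k → Fin N) → ℝ} {t : ℝ} (h : ∀ im, HasDerivAt (f im) (f' im) t) :
    HasDerivAt (fun s => avgIdx N p k (fun im => f im s)) (avgIdx N p k f') t :=
  (HasDerivAt.fun_sum fun im _ => h im).const_mul _

lemma avgIdx_one_succ (k : ℕ) (f : (Fin 1 → Fin (k + 1) → Fin N) → ℝ) :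
    avgIdx N 1 (k + 1) f =
      avgIdx N 1 k fun im => (N : ℝ)⁻¹ * ∑ x : Fin N, f fun l => Fin.cons x (im l) := by
  let e : (Fin N × (Fin 1 → Fin k → Fin N)) ≃ (Fin 1 → Fin (k + 1) → Fin N) :=
    { toFun := fun y l => Fin.cons y.1 (y.2 l)
      invFun := fun im => (im 0 0, fun l => Fin.tail (im l))
      left_inv := fun y => by simp
      right_inv := fun im => by
        funext l
        rw [Subsingleton.elim l 0]
        exact Fin.cons_self_tail _ }
  simp only [avgIdx]
  rw [← e.sum_comp f, Fintype.sum_prod_type_right, Finset.mul_sum, Finset.mul_sum]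
  refine Finset.sum_congr rfl fun im _ => ?_
  rw [← mul_assoc, ← mul_inv, one_mul, one_mul, pow_succ]
  rfl

variable {p : ℕ} {γ t : ℝ}

lemma hasSum_equenchCav (hN : 0 < N)
    {f : ℕ → (k : ℕ) → (Fin p → Fin k → Fin N) →
      (k' : ℕ) → (Fin (p - 1) → Fin k' → Fin N) → ℝ}
    {F : (k : ℕ) → (Fin p → Fin k → Fin N) →
      (k' : ℕ) → (Fin (p - 1) → Fin k' → Fin N) → ℝ} {c : ℕ → ℝ} (hc : Summable c)
    (hf : ∀ n k im k' im', |f n k im k' im'| ≤ c n)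
    (hF : ∀ k im k' im', HasSum (fun n => f n k im k' im') (F k im k' im')) :
    HasSum (fun n => EquenchCav N p γ t (f n)) (EquenchCav N p γ t F) := by
  refine hasSum_tsum_weight_mul (summable_abs_pois _)
    (hc.mul_left (∑' k, |pois (2 * γ * t) k|)) (fun n k => abs_avgIdx_le hN fun im =>
      abs_tsum_weight_mul_le (summable_abs_pois _) fun k' => abs_avgIdx_le hN fun im' =>
        hf n k im k' im') fun k => hasSum_avgIdx fun im =>
      hasSum_tsum_weight_mul (summable_abs_pois _) hc
        (fun n k' => abs_avgIdx_le hN fun im' => hf n k im k' im')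
        fun k' => hasSum_avgIdx fun im' => hF k im k' im'

lemma equenchCav_const_mul (c : ℝ)
    (f : (k : ℕ) → (Fin p → Fin k → Fin N) →
      (k' : ℕ) → (Fin (p - 1) → Fin k' → Fin N) → ℝ) :
    EquenchCav N p γ t (fun k im k' im' => c * f k im k' im') = c * EquenchCav N p γ t f := by
  simp only [EquenchCav, avgIdx, ← Finset.mul_sum, mul_left_comm _ c, tsum_mul_left]

lemma equenchCav_const_sub (hN : 0 < N) (c : ℝ) {B : ℝ}
    {f : (k : ℕ) → (Fin p → Fin k → Fin N) →
      (k' : ℕ) → (Fin (p - 1) → Fin k' → Fin N) → ℝ}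
    (hf : ∀ k im k' im', |f k im k' im'| ≤ B) :
    EquenchCav N p γ t (fun k im k' im' => c - f k im k' im') = c - EquenchCav N p γ t f := by
  have hin : ∀ k im, |∑' k', pois (2 * γ * t) k' * avgIdx N (p - 1) k' (f k im k')| ≤ _ :=
    fun k im => abs_tsum_weight_mul_le (summable_abs_pois _) fun k' =>
      abs_avgIdx_le hN fun im' => hf k im k' im'
  simp only [EquenchCav, avgIdx_const_sub hN]
  rw [← tsum_weight_mul_const_sub c (hasSum_pois _) fun k => abs_avgIdx_le hN (hin k)]
  refine tsum_congr fun k => ?_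
  rw [← avgIdx_const_sub hN]
  congr 2
  funext im
  exact tsum_weight_mul_const_sub c (hasSum_pois _) fun k' =>
    abs_avgIdx_le hN (hf k im k')

/-- The derivative in the Poisson mean of the cavity field is the average increment produced
by one additional cavity term. -/
lemma hasDerivAt_equenchCav (hN : 0 < N) {C : ℝ}
    {f D : (k : ℕ) → (Fin p → Fin k → Fin N) →
      (k' : ℕ) → (Fin (p - 1) → Fin k' → Fin N) → ℝ}
    (hf : ∀ k im k' im', |f k im k' im'| ≤ C * k')
    (hD : ∀ k im k' im', |D k im k' im'| ≤ C)
    (hfD : ∀ k im k', avgIdx N (p - 1) (k' + 1) (f k im (k' + 1)) -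
      avgIdx N (p - 1) k' (f k im k') = avgIdx N (p - 1) k' (D k im k')) (t : ℝ) :
    HasDerivAt (fun s => EquenchCav N p γ s f) (2 * γ * EquenchCav N p γ t D) t := by
  have hinner : ∀ k im s, HasDerivAt
      (fun s => ∑' k', pois (2 * γ * s) k' * avgIdx N (p - 1) k' (f k im k'))
      (2 * γ * ∑' k', pois (2 * γ * s) k' * avgIdx N (p - 1) k' (D k im k')) s := by
    intro k im s
    have h := (hasDerivAt_tsum_pois (a := fun k' => avgIdx N (p - 1) k' (f k im k'))
      (fun k' => abs_avgIdx_le hN fun im' => hf k im k' im') (2 * γ * s)).comp s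
      ((hasDerivAt_id s).const_mul (2 * γ))
    simp only [hfD, mul_one] at h
    rw [mul_comm (2 * γ) (∑' k', _)]
    exact h
  set M := |2 * γ| * (|t| + 1)
  have hM : ∀ s ∈ Set.Ioo (t - 1) (t + 1), |2 * γ * s| ≤ M := fun s hs => by
    rw [abs_mul]
    refine mul_le_mul_of_nonneg_left ?_ (abs_nonneg _)
    have hst : |s - t| ≤ 1 := abs_le.2 ⟨by linarith [hs.1], by linarith [hs.2]⟩
    linarith [abs_sub_abs_le_abs_sub s t]
  have hC : 0 ≤ C := (abs_nonneg _).trans (hD 0 (fun _ => Fin.elim0) 0 (fun _ => Fin.elim0))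
  have ht : t ∈ Set.Ioo (t - 1) (t + 1) := ⟨by linarith, by linarith⟩
  have hgrowth : ∀ k im, |∑' k', pois (2 * γ * t) k' * avgIdx N (p - 1) k' (f k im k')| ≤
      ∑' k', |pois (2 * γ * t) k'| * (C * k') := fun k im => by
    rw [← Real.norm_eq_abs]
    refine tsum_of_norm_bounded (Summable.hasSum ?_) fun k' => ?_
    · have h := (summable_pow_div_factorial_mul (a := fun k' => C * k') (C := C) (fun k' => by
        rw [abs_of_nonneg (by positivity)]
        exact mul_le_mul_of_nonneg_left (by exact_mod_cast Nat.lt_two_pow_self.le) hC)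
        (2 * γ * t)).abs.mul_left (Real.exp (-(2 * γ * t)))
      refine h.congr fun k' => ?_
      rw [pois, mul_div_assoc, abs_mul (Real.exp _), Real.abs_exp, abs_mul _ (C * _),
        abs_of_nonneg (by positivity : 0 ≤ C * (k' : ℝ))]
      ring
    · rw [Real.norm_eq_abs, abs_mul]
      exact mul_le_mul_of_nonneg_left (abs_avgIdx_le hN fun im' => hf k im k' im')
        (abs_nonneg _)
  have hbound : ∀ k im s, s ∈ Set.Ioo (t - 1) (t + 1) →
      |2 * γ * ∑' k', pois (2 * γ * s) k' * avgIdx N (p - 1) k' (D k im k')| ≤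
        |2 * γ| * (Real.exp (2 * M) * C) := fun k im s hs => by
    rw [abs_mul]
    refine mul_le_mul_of_nonneg_left ((abs_tsum_weight_mul_le (summable_abs_pois _)
      fun k' => abs_avgIdx_le hN fun im' => hD k im k' im').trans ?_) (abs_nonneg _)
    rw [tsum_abs_pois]
    gcongr
    linarith [hM s hs, neg_le_of_abs_le (hM s hs)]
  have h := hasDerivAt_tsum_of_isPreconnected
    ((summable_abs_pois (γ * N)).mul_right (|2 * γ| * (Real.exp (2 * M) * C)))
    isOpen_Ioo isPreconnected_Ioo
    (fun k s _ => (hasDerivAt_avgIdx fun im => hinner k im s).const_mul (pois (γ * N) k))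
    (fun k s hs => by
      rw [Real.norm_eq_abs, abs_mul]
      exact mul_le_mul_of_nonneg_left (abs_avgIdx_le hN fun im => hbound k im s hs)
        (abs_nonneg _))
    ht (summable_weight_mul (summable_abs_pois _) fun k => abs_avgIdx_le hN (hgrowth k)) ht
  refine h.congr_deriv ?_
  rw [EquenchCav, ← tsum_mul_left]
  refine tsum_congr fun k => ?_
  simp only [avgIdx, ← Finset.mul_sum]
  ring

end QuenchedAverage

section Boltzmann

/-- Changing the exponent by at most `c` changes the log-partition function by at most `c`. -/
lemma abs_log_sum_exp_div_le {ι : Type*} [Fintype ι] [Nonempty ι] {f g : ι → ℝ} {c : ℝ}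
    (hg : ∀ i, |g i| ≤ c) :
    |Real.log ((∑ i, Real.exp (f i + g i)) / ∑ i, Real.exp (f i))| ≤ c := by
  have hpos : 0 < ∑ i, Real.exp (f i) :=
    Finset.sum_pos (fun i _ => Real.exp_pos _) Finset.univ_nonempty
  have hpos' : 0 < ∑ i, Real.exp (f i + g i) :=
    Finset.sum_pos (fun i _ => Real.exp_pos _) Finset.univ_nonempty
  rw [abs_le]
  constructor
  · rw [Real.le_log_iff_exp_le (by positivity), le_div_iff₀ hpos, Finset.mul_sum]
    refine Finset.sum_le_sum fun i _ => ?_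
    rw [← Real.exp_add]
    exact Real.exp_le_exp.2 (by linarith [neg_le_of_abs_le (hg i)])
  · rw [Real.log_le_iff_le_exp (by positivity), div_le_iff₀ hpos, Finset.mul_sum]
    refine Finset.sum_le_sum fun i _ => ?_
    rw [← Real.exp_add]
    exact Real.exp_le_exp.2 (by linarith [le_of_abs_le (hg i)])

lemma abs_spin (b : Bool) : |spin b| = 1 := by cases b <;> simp [spin]

lemma exp_mul_spin (β : ℝ) (b : Bool) :
    Real.exp (β * spin b) = Real.cosh β * (1 + Real.tanh β * spin b) := by
  have hc : Real.cosh β ≠ 0 := (Real.cosh_pos β).ne'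
  rw [Real.tanh_eq_sinh_div_cosh]
  cases b
  · simp only [spin, Bool.false_eq_true, if_false]
    field_simp
    rw [← Real.cosh_sub_sinh, sub_eq_add_neg]
  · simp only [spin, if_true]
    field_simp
    exact (Real.cosh_add_sinh β).symm

variable {N p k q k' : ℕ}

lemma abs_cavSum_le (im' : Fin q → Fin k' → Fin N) (σ : Fin N → Bool) :
    |cavSum im' σ| ≤ k' := by
  refine (Finset.abs_sum_le_sum_abs _ _).trans ?_
  simp [Finset.abs_prod, abs_spin]

lemma cavSum_cons (im' : Fin 1 → Fin k' → Fin N) (x : Fin N) (σ : Fin N → Bool) :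
    cavSum (fun l => Fin.cons x (im' l)) σ = spin (σ x) + cavSum im' σ := by
  simp [cavSum, Fin.sum_univ_succ]

lemma Zpart_pos (β : ℝ) (im : Fin p → Fin k → Fin N) : 0 < Zpart β im :=
  Finset.sum_pos (fun _ _ => Real.exp_pos _) Finset.univ_nonempty

lemma Zpert_pos (β : ℝ) (im : Fin p → Fin k → Fin N) (im' : Fin q → Fin k' → Fin N) :
    0 < Zpert β im im' :=
  Finset.sum_pos (fun _ _ => Real.exp_pos _) Finset.univ_nonempty

lemma abs_log_Zpert_div_Zpart_le {β : ℝ} (hβ : 0 ≤ β) (im : Fin p → Fin k → Fin N)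
    (im' : Fin q → Fin k' → Fin N) :
    |Real.log (Zpert β im im' / Zpart β im)| ≤ β * k' := by
  simp only [Zpert, wpert, Zpart, mul_add]
  refine abs_log_sum_exp_div_le fun σ => ?_
  rw [abs_mul, abs_of_nonneg hβ]
  exact mul_le_mul_of_nonneg_left (abs_cavSum_le im' σ) hβ

/-- The magnetization of site `x` in the perturbed Boltzmann state. -/
noncomputable def magPert (β : ℝ) (im : Fin p → Fin k → Fin N) (im' : Fin q → Fin k' → Fin N)
    (x : Fin N) : ℝ :=
  (∑ σ : Fin N → Bool, spin (σ x) * wpert β im im' σ) / Zpert β im im'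

lemma abs_magPert_le (β : ℝ) (im : Fin p → Fin k → Fin N) (im' : Fin q → Fin k' → Fin N)
    (x : Fin N) : |magPert β im im' x| ≤ 1 := by
  rw [magPert, abs_div, abs_of_pos (Zpert_pos β im im'), div_le_one (Zpert_pos β im im')]
  refine (Finset.abs_sum_le_sum_abs _ _).trans_eq (Finset.sum_congr rfl fun σ _ => ?_)
  rw [abs_mul, abs_spin, one_mul, wpert, Real.abs_exp]

lemma OmegaPert_qOv (β : ℝ) (im : Fin p → Fin k → Fin N) (im' : Fin q → Fin k' → Fin N)
    (n : ℕ) : OmegaPert β im im' n (fun σs => qOv N n σs ^ 1) =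
      (N : ℝ)⁻¹ * ∑ x, magPert β im im' x ^ n := by
  simp only [OmegaPert, qOv, magPert, div_pow, Fintype.sum_pow, pow_one, ← Finset.sum_div,
    mul_assoc, Finset.sum_mul, ← Finset.mul_sum, Finset.prod_mul_distrib]
  rw [Finset.sum_comm, mul_div_assoc]

lemma Zpert_cons_div (β : ℝ) (im : Fin p → Fin k → Fin N) (im' : Fin 1 → Fin k' → Fin N)
    (x : Fin N) :
    Zpert β im (fun l => Fin.cons x (im' l) : Fin 1 → Fin (k' + 1) → Fin N) / Zpert β im im' =
      Real.cosh β * (1 + Real.tanh β * magPert β im im' x) := by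
  have hZ := (Zpert_pos β im im').ne'
  have h : Zpert β im (fun l => Fin.cons x (im' l) : Fin 1 → Fin (k' + 1) → Fin N) =
      Real.cosh β * (Zpert β im im' +
        Real.tanh β * ∑ σ : Fin N → Bool, spin (σ x) * wpert β im im' σ) := by
    simp only [Zpert, Finset.mul_sum, ← Finset.sum_add_distrib]
    refine Finset.sum_congr rfl fun σ _ => ?_
    have : wpert β im (fun l => Fin.cons x (im' l) : Fin 1 → Fin (k' + 1) → Fin N) σ =
        wpert β im im' σ * Real.exp (β * spin (σ x)) := by
      rw [wpert, wpert, cavSum_cons, ← Real.exp_add]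
      ring_nf
    rw [this, exp_mul_spin]
    ring
  rw [h, magPert]
  field_simp

lemma abs_log_Zpert_cons_div_le {β : ℝ} (hβ : 0 ≤ β) (im : Fin p → Fin k → Fin N)
    (im' : Fin 1 → Fin k' → Fin N) (x : Fin N) :
    |Real.log (Zpert β im (fun l => Fin.cons x (im' l) : Fin 1 → Fin (k' + 1) → Fin N) /
      Zpert β im im')| ≤ β := by
  have hsplit : ∀ σ, β * (intSum im σ + cavSum (fun l => Fin.cons x (im' l)) σ) =
      β * (intSum im σ + cavSum im' σ) + β * spin (σ x) := fun σ => by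
    rw [cavSum_cons]
    ring
  simp only [Zpert, wpert, hsplit]
  refine abs_log_sum_exp_div_le fun σ => ?_
  rw [abs_mul, abs_spin, abs_of_nonneg hβ, mul_one]

lemma abs_OmegaPert_qOv_le (hN : 0 < N) (β : ℝ) (im : Fin p → Fin k → Fin N)
    (im' : Fin q → Fin k' → Fin N) (n : ℕ) :
    |OmegaPert β im im' n (fun σs => qOv N n σs ^ 1)| ≤ 1 := by
  have hN' : (0 : ℝ) < N := by exact_mod_cast hN
  rw [OmegaPert_qOv, abs_mul, abs_of_pos (inv_pos.2 hN'), inv_mul_le_one₀ hN']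
  refine (Finset.abs_sum_le_sum_abs _ _).trans ?_
  refine (Finset.sum_le_card_nsmul _ _ 1 fun x _ => ?_).trans_eq (by simp)
  rw [abs_pow]
  exact pow_le_one₀ (abs_nonneg _) (abs_magPert_le β im im' x)

lemma abs_tanh_mul_magPert_lt_one (β : ℝ) (im : Fin p → Fin k → Fin N)
    (im' : Fin q → Fin k' → Fin N) (x : Fin N) :
    |Real.tanh β * magPert β im im' x| < 1 := by
  rw [abs_mul]
  exact mul_lt_one_of_nonneg_of_lt_one_left (abs_nonneg _) (Real.abs_tanh_lt_one β)
    (abs_magPert_le β im im' x)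

/-- Expansion of the one-spin cavity increment in powers of `tanh β`. -/
lemma hasSum_OmegaPert_qOv (β : ℝ) (im : Fin p → Fin k → Fin N)
    (im' : Fin q → Fin k' → Fin N) :
    HasSum (fun n : ℕ => ((-1 : ℝ) ^ (n + 1) / ((n : ℝ) + 1)) * Real.tanh β ^ (n + 1) *
        OmegaPert β im im' (n + 1) (fun σs => qOv N (n + 1) σs ^ 1))
      (-((N : ℝ)⁻¹ * ∑ x, Real.log (1 + Real.tanh β * magPert β im im' x))) := by
  have h := (hasSum_sum (s := Finset.univ) fun x _ => Real.hasSum_pow_div_log_of_abs_lt_one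
    ((abs_neg _).trans_lt (abs_tanh_mul_magPert_lt_one β im im' x))).mul_left (N : ℝ)⁻¹
  simp only [sub_neg_eq_add, Finset.sum_neg_distrib, mul_neg] at h
  refine h.congr_fun fun n => ?_
  rw [OmegaPert_qOv, mul_left_comm, Finset.mul_sum]
  congr 1
  refine Finset.sum_congr rfl fun x _ => ?_
  rw [← neg_one_mul (Real.tanh β * _), mul_pow, mul_pow]
  ring

lemma avg_log_Zpert_cons_div (hN : 0 < N) (β : ℝ) (im : Fin p → Fin k → Fin N)
    (im' : Fin 1 → Fin k' → Fin N) :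
    (N : ℝ)⁻¹ * ∑ x, Real.log
        (Zpert β im (fun l => Fin.cons x (im' l) : Fin 1 → Fin (k' + 1) → Fin N) /
          Zpert β im im') =
      Real.log (Real.cosh β) +
        (N : ℝ)⁻¹ * ∑ x, Real.log (1 + Real.tanh β * magPert β im im' x) := by
  have hN' : (N : ℝ) ≠ 0 := by positivity
  have hlog : ∀ x, Real.log (Real.cosh β * (1 + Real.tanh β * magPert β im im' x)) =
      Real.log (Real.cosh β) + Real.log (1 + Real.tanh β * magPert β im im' x) := fun x =>
    Real.log_mul (Real.cosh_pos β).ne'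
      (by linarith [neg_lt_of_abs_lt (abs_tanh_mul_magPert_lt_one β im im' x)])
  simp only [Zpert_cons_div, hlog, Finset.sum_add_distrib]
  rw [mul_add]
  simp [hN']

lemma abs_avg_log_Zpert_cons_div_le (hN : 0 < N) {β : ℝ} (hβ : 0 ≤ β)
    (im : Fin p → Fin k → Fin N) (im' : Fin 1 → Fin k' → Fin N) :
    |(N : ℝ)⁻¹ * ∑ x, Real.log
        (Zpert β im (fun l => Fin.cons x (im' l) : Fin 1 → Fin (k' + 1) → Fin N) /
          Zpert β im im')| ≤ β := by
  have hN' : (0 : ℝ) < N := by exact_mod_cast hN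
  rw [abs_mul, abs_of_pos (inv_pos.2 hN'), inv_mul_le_iff₀ hN']
  refine (Finset.abs_sum_le_sum_abs _ _).trans ?_
  exact (Finset.sum_le_card_nsmul _ _ β fun x _ =>
    abs_log_Zpert_cons_div_le hβ im im' x).trans_eq (by simp)

lemma avgIdx_log_Zpert_succ_sub (hN : 0 < N) (β : ℝ) (im : Fin p → Fin k → Fin N) (k' : ℕ) :
    avgIdx N 1 (k' + 1) (fun im' => Real.log (Zpert β im im' / Zpart β im)) -
        avgIdx N 1 k' (fun im' => Real.log (Zpert β im im' / Zpart β im)) =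
      avgIdx N 1 k' fun im' => (N : ℝ)⁻¹ * ∑ x, Real.log
        (Zpert β im (fun l => Fin.cons x (im' l) : Fin 1 → Fin (k' + 1) → Fin N) /
          Zpert β im im') := by
  have hN' : (N : ℝ) ≠ 0 := by positivity
  rw [avgIdx_one_succ, ← avgIdx_sub]
  congr 1
  funext im'
  simp only [Real.log_div (Zpert_pos _ _ _).ne' (Zpert_pos _ _ _).ne',
    Real.log_div (Zpert_pos _ _ _).ne' (Zpart_pos _ _).ne', Finset.sum_sub_distrib]
  simp only [Finset.sum_const, Finset.card_univ, Fintype.card_fin, nsmul_eq_mul]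
  field_simp
  ring

end Boltzmann

/-- `t`-streaming of the cavity function for the diluted Curie–Weiss model (`p = 2`,
`γ = α`): for every `t ∈ [0,1]`,
`∂_t Ψ_N(α,β,t) = 2α ln cosh β - 2α ∑_{n≥1} ((-1)^n/n) θ^n ⟨q_{1…n}⟩_{N,t}`,
with `θ = tanh β`, the series being absolutely convergent. -/
theorem cavity_t_derivative (N : ℕ) (hN : 0 < N) (α β : ℝ) (hα : 0 < α) (hβ : 0 < β)
    (t : ℝ) (ht : t ∈ Set.Icc (0 : ℝ) 1) :
    Summable (fun n : ℕ =>
      |((-1 : ℝ) ^ (n + 1) / ((n : ℝ) + 1)) * Real.tanh β ^ (n + 1) *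
        qPowAvgPert N 2 α β t (n + 1) 1|) ∧
    HasDerivAt (fun t' : ℝ => cavityFn N 2 α β t')
      (2 * α * Real.log (Real.cosh β) -
        2 * α * ∑' n : ℕ, ((-1 : ℝ) ^ (n + 1) / ((n : ℝ) + 1)) * Real.tanh β ^ (n + 1) *
          qPowAvgPert N 2 α β t (n + 1) 1) t := by
  have hc : Summable fun n : ℕ => |Real.tanh β| ^ (n + 1) :=
    (summable_nat_add_iff 1).2
      (summable_geometric_of_lt_one (abs_nonneg _) (Real.abs_tanh_lt_one β))
  have hterm : ∀ (n k : ℕ) (im : Fin 2 → Fin k → Fin N) (k' : ℕ)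
      (im' : Fin 1 → Fin k' → Fin N),
      |((-1 : ℝ) ^ (n + 1) / ((n : ℝ) + 1)) * Real.tanh β ^ (n + 1) *
        OmegaPert β im im' (n + 1) (fun σs => qOv N (n + 1) σs ^ 1)| ≤
      |Real.tanh β| ^ (n + 1) := by
    intro n k im k' im'
    have hn : |(n : ℝ) + 1| = n + 1 := abs_of_pos (by positivity)
    rw [abs_mul, abs_mul, abs_div, abs_pow, abs_neg, abs_one, one_pow, abs_pow, hn]
    refine (mul_le_of_le_one_right (by positivity) (abs_OmegaPert_qOv_le hN β im im' _)).trans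
      (mul_le_of_le_one_left (by positivity) ?_)
    rw [div_le_one (by positivity)]
    linarith [n.cast_nonneg (α := ℝ)]
  have hseries := hasSum_equenchCav (p := 2) (γ := α) (t := t) hN hc hterm
    fun k im k' im' => hasSum_OmegaPert_qOv β im im'
  simp only [equenchCav_const_mul] at hseries
  refine ⟨hseries.summable.abs, ?_⟩
  have hderiv := hasDerivAt_equenchCav (p := 2) (γ := α) hN
    (fun k im k' im' => abs_log_Zpert_div_Zpart_le hβ.le im im')
    (fun k im k' im' => abs_avg_log_Zpert_cons_div_le hN hβ.le im im')
    (fun k im k' => avgIdx_log_Zpert_succ_sub hN β im k') t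
  refine hderiv.congr_deriv ?_
  have hsum := hseries.tsum_eq
  simp only [qPowAvgPert]
  rw [hsum, ← mul_sub, ← equenchCav_const_sub hN (B := ∑' n : ℕ, |Real.tanh β| ^ (n + 1))]
  · congr 2
    funext k im k' im'
    rw [sub_neg_eq_add]
    exact avg_log_Zpert_cons_div hN β im im'
  · intro k im k' im'
    rw [← (hasSum_OmegaPert_qOv β im im').tsum_eq]
    rw [← Real.norm_eq_abs]
    exact tsum_of_norm_bounded hc.hasSum fun n => hterm n k im k' im'
end
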